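/- (Dominance lemma for profiles' positive flows.) Let r : Fin (k+1) → X be limiting profiles, all pairwise distinct, and let a and b be alternatives, each distinct from all profiles. Suppose a dominates b: g a j ≥ g b j for every criterion j. Then, with R_a = {r 0, …, r k, a} and R_b = {r 0, …, r k, b}, for every profile r h the positive Choquet-flows satisfy φ⁺_{R_a}(r h) ≤ φ⁺_{R_b}(r h). -/

import Mathlib

open Finset

/-- The 2-additive Choquet integral (Möbius form). -/
noncomputable def CI2 (n : ℕ) (m : Fin n → ℝ) (M : Fin n → Fin n → ℝ)
    (P : Fin n → ℝ) : ℝ :=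
  ∑ j, m j * P j + ∑ j, ∑ s, if j < s then M j s * min (P j) (P s) else 0

/-- The Choquet-outranking degree of `x` over `y` built from evaluations `g` and
preference functions `F`. -/
noncomputable def outrank {X : Type*} (n : ℕ) (m : Fin n → ℝ) (M : Fin n → Fin n → ℝ)
    (g : X → Fin n → ℝ) (F : Fin n → ℝ → ℝ) (x y : X) : ℝ :=
  CI2 n m M (fun j => F j (g x j - g y j))

/-- The positive Choquet-flow of `x` within the finite set `S`. -/
noncomputable def posFlow {X : Type*} [DecidableEq X] (π : X → X → ℝ)
    (S : Finset X) (x : X) : ℝ :=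
  (1 / ((S.card : ℝ) - 1)) * ∑ y ∈ S.erase x, π x y

/-- The negative Choquet-flow of `x` within the finite set `S`. -/
noncomputable def negFlow {X : Type*} [DecidableEq X] (π : X → X → ℝ)
    (S : Finset X) (x : X) : ℝ :=
  (1 / ((S.card : ℝ) - 1)) * ∑ y ∈ S.erase x, π y x

/-- The net Choquet-flow of `x` within the finite set `S`. -/
noncomputable def netFlow {X : Type*} [DecidableEq X] (π : X → X → ℝ)
    (S : Finset X) (x : X) : ℝ :=
  posFlow π S x - negFlow π S x

/-- If every partial sum of weights stays above `-c`, then so does every sum of the weights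
against increments lying in `[0, D]`, after scaling by `D`. -/
lemma mul_add_sum_mul_nonneg {ι : Type*} [Fintype ι] [DecidableEq ι] (i : ι) (c D : ℝ)
    (w α : ι → ℝ) (hwi : w i = 0) (hc : ∀ S : Finset ι, i ∉ S → 0 ≤ c + ∑ s ∈ S, w s)
    (hD : 0 ≤ D) (hα0 : ∀ s, 0 ≤ α s) (hαD : ∀ s, α s ≤ D) :
    0 ≤ c * D + ∑ s, w s * α s := by
  have hS := mul_nonneg (hc (univ.filter fun s => w s < 0) (by simp [hwi])) hD
  have hle : (∑ s ∈ univ.filter (fun s => w s < 0), w s) * D ≤ ∑ s, w s * α s := by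
    rw [sum_mul, sum_filter]
    refine sum_le_sum fun s _ => ?_
    split_ifs with hs
    · exact mul_le_mul_of_nonpos_left (hαD s) hs.le
    · exact mul_nonneg (not_lt.mp hs) (hα0 s)
  linarith

/-- The sum over all pairs `j < s` of a symmetric weight against `α j s + α s j` is the sum over
all ordered pairs of the weight against `α`. -/
lemma sum_lt_mul_add_swap {ι : Type*} [Fintype ι] [LinearOrder ι] (M α : ι → ι → ℝ)
    (hsymm : ∀ j s, M j s = M s j) (hdiag : ∀ j, M j j = 0) :
    (∑ j, ∑ s, if j < s then M j s * (α j s + α s j) else 0) = ∑ j, ∑ s, M j s * α j s := by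
  have hswap : (∑ j, ∑ s, if j < s then M j s * α s j else 0)
      = ∑ j, ∑ s, if s < j then M j s * α j s else 0 := by
    rw [sum_comm]
    simp only [hsymm]
  have hsplit : (∑ j, ∑ s, if j < s then M j s * (α j s + α s j) else 0)
      = (∑ j, ∑ s, if j < s then M j s * α j s else 0)
        + ∑ j, ∑ s, if j < s then M j s * α s j else 0 := by
    simp only [← sum_add_distrib]
    refine sum_congr rfl fun j _ => sum_congr rfl fun s _ => ?_
    split_ifs <;> ring
  rw [hsplit, hswap]
  simp only [← sum_add_distrib]
  refine sum_congr rfl fun j _ => sum_congr rfl fun s _ => ?_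
  rcases lt_trichotomy j s with h | rfl | h
  · simp [h, h.not_gt]
  · simp [hdiag]
  · simp [h, h.not_gt]

lemma min_sub_min_right_mem_Icc {p q : ℝ} (h : p ≤ q) (t : ℝ) :
    min q t - min p t ∈ Set.Icc 0 (q - p) := by
  constructor <;> grind

/-- The 2-additive Choquet integral is monotone. -/
lemma CI2_mono (n : ℕ) (m : Fin n → ℝ) (M : Fin n → Fin n → ℝ)
    (hsymm : ∀ j s, M j s = M s j) (hdiag : ∀ j, M j j = 0)
    (hmono : ∀ j (S : Finset (Fin n)), j ∉ S → 0 ≤ m j + ∑ s ∈ S, M j s) :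
    Monotone (CI2 n m M) := by
  intro P Q hPQ
  -- The part of the increment of `min (P j) (P s)` due to the coordinate `j`, averaged over
  -- the two orders in which the coordinates `j` and `s` can be raised.
  let α : Fin n → Fin n → ℝ := fun j s =>
    ((min (Q j) (Q s) - min (P j) (Q s)) + (min (Q j) (P s) - min (P j) (P s))) / 2
  have hα (j s : Fin n) : α j s + α s j = min (Q j) (Q s) - min (P j) (P s) := by
    simp only [α, min_comm (Q s), min_comm (P s)]
    ring
  have hα_mem (j s : Fin n) : α j s ∈ Set.Icc 0 (Q j - P j) := by
    obtain ⟨h₁, h₂⟩ := min_sub_min_right_mem_Icc (hPQ j) (Q s)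
    obtain ⟨h₃, h₄⟩ := min_sub_min_right_mem_Icc (hPQ j) (P s)
    constructor <;> simp only [α] <;> linarith
  have hdiff : CI2 n m M Q - CI2 n m M P
      = ∑ j, (m j * (Q j - P j) + ∑ s, M j s * α j s) := by
    rw [sum_add_distrib, ← sum_lt_mul_add_swap M α hsymm hdiag]
    simp only [hα, CI2]
    rw [add_sub_add_comm]
    simp only [← sum_sub_distrib]
    congr 1
    · exact sum_congr rfl fun j _ => by ring
    · refine sum_congr rfl fun j _ => sum_congr rfl fun s _ => ?_
      split_ifs <;> ring
  rw [← sub_nonneg, hdiff]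
  exact sum_nonneg fun j _ => mul_add_sum_mul_nonneg j (m j) _ (M j) (α j) (hdiag j) (hmono j)
    (sub_nonneg.mpr (hPQ j)) (fun s => (hα_mem j s).1) (fun s => (hα_mem j s).2)

lemma posFlow_insert {X : Type*} [DecidableEq X] (π : X → X → ℝ) {S : Finset X} {a x : X}
    (ha : a ∉ S) (hx : x ∈ S) :
    posFlow π (insert a S) x = (1 / (S.card : ℝ)) * (π x a + ∑ y ∈ S.erase x, π x y) := by
  have hax : a ≠ x := fun h => ha (h ▸ hx)
  rw [posFlow, erase_insert_of_ne hax, sum_insert (fun h => ha (mem_of_mem_erase h)),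
    card_insert_of_notMem ha]
  simp

/-- Dominance lemma, profiles' positive flows: if `a` dominates `b`,
then every profile's positive Choquet-flow in `R_a` is at most its flow in `R_b`. -/
theorem dominance_posFlow_profiles {X : Type*} [DecidableEq X] (n k : ℕ)
    (m : Fin n → ℝ) (M : Fin n → Fin n → ℝ)
    (hsymm : ∀ j s, M j s = M s j) (hdiag : ∀ j, M j j = 0)
    (hmono1 : ∀ j, 0 ≤ m j)
    (hmono2 : ∀ j (S : Finset (Fin n)), j ∉ S → 0 ≤ m j + ∑ s ∈ S, M j s)
    (g : X → Fin n → ℝ) (F : Fin n → ℝ → ℝ)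
    (hF1 : ∀ j, Monotone (F j))
    (hF2 : ∀ j d, 0 ≤ F j d ∧ F j d ≤ 1)
    (hF3 : ∀ j d, d ≤ 0 → F j d = 0)
    (r : Fin (k + 1) → X)
    (hinj : Function.Injective r)
    (a b : X) (ha : ∀ h, a ≠ r h) (hb : ∀ h, b ≠ r h)
    (hdom : ∀ j, g b j ≤ g a j) :
    ∀ h : Fin (k + 1),
      posFlow (outrank n m M g F) (insert a (Finset.image r Finset.univ)) (r h)
        ≤ posFlow (outrank n m M g F) (insert b (Finset.image r Finset.univ)) (r h) := by
  intro h
  have hr : r h ∈ image r univ := mem_image_of_mem r (mem_univ h)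
  have ha' : a ∉ image r univ := by simpa using fun i => (ha i).symm
  have hb' : b ∉ image r univ := by simpa using fun i => (hb i).symm
  rw [posFlow_insert _ ha' hr, posFlow_insert _ hb' hr]
  have hπ : outrank n m M g F (r h) a ≤ outrank n m M g F (r h) b :=
    CI2_mono n m M hsymm hdiag hmono2 fun j => hF1 j (sub_le_sub_left (hdom j) _)
  gcongr
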